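/- arXiv:2502.07000 — 8 statements merged into one kernel-verified Lean document; each statement's English description precedes it below -/
import Mathlib

section
/- Let a > 0 and b > 0 be real numbers with a^2 - 4b < 0. Then there is no sequence (y_i)_{i≥0} of positive real numbers satisfying y_{i+2} ≤ a·y_{i+1} - b·y_i for all i ≥ 0. -/
theorem stmt_0 (a b : ℝ) (ha : 0 < a) (hb : 0 < b) (hdisc : a ^ 2 - 4 * b < 0) :
    ¬ ∃ y : ℕ → ℝ, (∀ i, 0 < y i) ∧ ∀ i, y (i + 2) ≤ a * y (i + 1) - b * y i := by
  rintro ⟨y, hy, h⟩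
  obtain ⟨r, hr⟩ : ∃ r : ℕ → ℝ, ∀ i, r i = y (i + 1) / y i := ⟨_, fun _ => rfl⟩
  have hpos : ∀ i, 0 < r i := fun i => by rw [hr]; exact div_pos (hy _) (hy _)
  have hstep : ∀ i, r (i + 1) * r i ≤ a * r i - b := by
    intro i
    have h0 := hy i
    have h1 := hy (i + 1)
    have e : r (i + 1) * r i = y (i + 2) / y i := by
      rw [hr, hr]; field_simp
    have e2 : a * r i - b = (a * y (i + 1) - b * y i) / y i := by
      rw [hr]; field_simp
    rw [e, e2]
    exact div_le_div_of_nonneg_right (h i) h0.le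
  obtain ⟨c, hc⟩ : ∃ c, c = b - a ^ 2 / 4 := ⟨_, rfl⟩
  have hcpos : 0 < c := by rw [hc]; linarith
  have hdec : ∀ i, r (i + 1) ≤ r i - c / r i := by
    intro i
    have hp := hpos i
    have e : r i - c / r i = (r i * r i - c) / r i := by field_simp
    rw [e, le_div_iff₀ hp]
    nlinarith [hstep i, sq_nonneg (r i - a / 2)]
  have hd : 0 < c / r 0 := div_pos hcpos (hpos 0)
  have hall : ∀ n : ℕ, r n ≤ r 0 - n * (c / r 0) := by
    intro n
    induction n with
    | zero => simp
    | succ n ih =>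
      have hle : r n ≤ r 0 := by
        have : 0 ≤ (n : ℝ) * (c / r 0) := by positivity
        linarith
      have := div_le_div_of_nonneg_left hcpos.le (hpos n) hle
      have := hdec n
      push_cast
      linarith
  obtain ⟨n, hn⟩ := exists_nat_gt (r 0 / (c / r 0))
  rw [div_lt_iff₀ hd] at hn
  linarith [hall n, hpos n]
end

section
/- Let κ > 0 be a real number. Then there is no sequence (z_i)_{i≥0} of positive real numbers satisfying z_{i+2} - 2·z_{i+1} + z_i ≤ -κ·z_{i+2} for all i ≥ 0. -/
theorem stmt_1 (κ : ℝ) (hκ : 0 < κ) :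
    ¬ ∃ z : ℕ → ℝ, (∀ i, 0 < z i) ∧
      ∀ i, z (i + 2) - 2 * z (i + 1) + z i ≤ -κ * z (i + 2) := by
  rintro ⟨z, hz, h⟩
  have hd : ∀ i, 0 ≤ z (i + 1) - z i := by
    intro i
    by_contra hneg
    push Not at hneg
    have key : ∀ n : ℕ, z (i + n + 1) - z (i + n) ≤ z (i + 1) - z i ∧
        z (i + n) ≤ z i + n * (z (i + 1) - z i) := by
      intro n
      induction n with
      | zero => simp
      | succ k ih =>
        have h1 := h (i + k)
        have h2 := mul_pos hκ (hz (i + k + 2))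
        obtain ⟨a, b⟩ := ih
        have e1 : i + (k + 1) = i + k + 1 := by omega
        have e2 : i + k + 1 + 1 = i + k + 2 := by omega
        rw [e1, e2]
        push_cast
        constructor <;> linarith
    obtain ⟨n, hn⟩ := exists_nat_gt (z i / -(z (i + 1) - z i))
    rw [div_lt_iff₀ (by linarith)] at hn
    have := (key n).2
    have := hz (i + n)
    linarith
  have hm : ∀ n, z 0 ≤ z n := by
    intro n
    induction n with
    | zero => exact le_refl _
    | succ k ih => linarith [hd k]
  have key : ∀ n : ℕ, z (n + 1) - z n ≤ z 1 - z 0 - n * (κ * z 0) := by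
    intro n
    induction n with
    | zero => simp
    | succ k ih =>
      have h1 := h k
      have h2 := mul_le_mul_of_nonneg_left (hm (k + 2)) hκ.le
      have e2 : k + 1 + 1 = k + 2 := by omega
      rw [e2]
      push_cast
      linarith
  obtain ⟨n, hn⟩ := exists_nat_gt ((z 1 - z 0) / (κ * z 0))
  rw [div_lt_iff₀ (mul_pos hκ (hz 0))] at hn
  linarith [key n, hd n]
end

section
/- Let a > 0 and b > 0 be real numbers and let (y_i)_{i≥0} be a sequence of positive real numbers satisfying y_{i+2} ≤ a·y_{i+1} - b·y_i for all i ≥ 0. Define z_i = (a/(2b))^i · y_i. Then for all i ≥ 0, z_{i+2} - 2·z_{i+1} + z_i ≤ ((a^2 - 4b)/a^2) · z_{i+2}. -/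
theorem stmt_2 (a b : ℝ) (ha : 0 < a) (hb : 0 < b) (y : ℕ → ℝ)
    (hy : ∀ i, 0 < y i) (hrec : ∀ i, y (i + 2) ≤ a * y (i + 1) - b * y i)
    (z : ℕ → ℝ) (hz : ∀ i, z i = (a / (2 * b)) ^ i * y i) :
    ∀ i, z (i + 2) - 2 * z (i + 1) + z i ≤ ((a ^ 2 - 4 * b) / a ^ 2) * z (i + 2) := by
  intro i
  have h0 : 0 ≤ (a / (2 * b)) ^ i * ((a * y (i + 1) - b * y i - y (i + 2)) / b) := by
    have := hrec i
    have h1 : 0 ≤ a * y (i + 1) - b * y i - y (i + 2) := by linarith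
    positivity
  rw [hz, hz, hz, pow_succ, pow_succ]
  generalize (a / (2 * b)) ^ i = c at *
  have key : (a ^ 2 - 4 * b) / a ^ 2 * (c * (a / (2 * b)) * (a / (2 * b)) * y (i + 2)) -
      (c * (a / (2 * b)) * (a / (2 * b)) * y (i + 2) - 2 * (c * (a / (2 * b)) * y (i + 1)) + c * y i)
      = c * ((a * y (i + 1) - b * y i - y (i + 2)) / b) := by
    field_simp
    ring
  linarith
end

section
/- For every real number p > 0, D_p(2p + 1 + √(8p)) = -16·p^{3/2}·(√8·p + 5·√p + √8); in particular D_p(2p + 1 + √(8p)) < 0. -/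
def D (p c : ℝ) : ℝ := (c - 1) ^ 4 - 4 * p * (c + 1) ^ 2 * (c - p - 1)

theorem stmt_5 (p : ℝ) (hp : 0 < p) :
    D p (2 * p + 1 + Real.sqrt (8 * p)) =
      -16 * (p * Real.sqrt p) * (Real.sqrt 8 * p + 5 * Real.sqrt p + Real.sqrt 8) ∧
    D p (2 * p + 1 + Real.sqrt (8 * p)) < 0 := by
  have h1 : Real.sqrt (8 * p) = Real.sqrt 8 * Real.sqrt p := Real.sqrt_mul (by norm_num) p
  have he : Real.sqrt 8 ^ 2 = 8 := Real.sq_sqrt (by norm_num)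
  have hs : p = Real.sqrt p ^ 2 := (Real.sq_sqrt hp.le).symm
  have hs0 : 0 < Real.sqrt p := Real.sqrt_pos.mpr hp
  have he0 : 0 < Real.sqrt 8 := Real.sqrt_pos.mpr (by norm_num)
  have key : D p (2 * p + 1 + Real.sqrt (8 * p)) =
      -16 * (p * Real.sqrt p) * (Real.sqrt 8 * p + 5 * Real.sqrt p + Real.sqrt 8) := by
    rw [h1]
    unfold D
    generalize Real.sqrt p = s at *
    generalize Real.sqrt 8 = e at *
    subst hs
    have e3 : e ^ 3 = 8 * e := by rw [pow_succ, he]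
    have e4 : e ^ 4 = 64 := by rw [show e ^ 4 = (e ^ 2) ^ 2 by ring, he]; norm_num
    ring_nf
    simp only [he, e3, e4]
    ring
  refine ⟨key, ?_⟩
  rw [key]
  have : 0 < (p * Real.sqrt p) * (Real.sqrt 8 * p + 5 * Real.sqrt p + Real.sqrt 8) := by positivity
  linarith
end

section
/- Let p ≥ 2 be a real number. Then there exists a unique c* in the interval [2p+1+√(8p), ∞) with D_p(c*) = 0; moreover D_p(c) < 0 for all c in [2p+1+√(8p), c*) and D_p(c) > 0 for all c > c*. In other words, D_p transitions from negative to positive exactly once within [2p+1+√(8p), ∞). -/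
lemma D_exp (p s t : ℝ) (h : 8 * p = s ^ 2) :
    D p (2 * p + 1 + s + t) = t ^ 4 + (s ^ 2 / 2 + 4 * s) * t ^ 3
      + (s ^ 4 / 16 + 3 * s ^ 3 / 2 + 4 * s ^ 2) * t ^ 2
      + ((D p (2 * p + 1 + s + 1) - D p (2 * p + 1 + s)) - 1 - (s ^ 2 / 2 + 4 * s)
        - (s ^ 4 / 16 + 3 * s ^ 3 / 2 + 4 * s ^ 2)) * t
      - s ^ 3 * (64 * s ^ 2 + 320 * s + 512) / 256 := by
  obtain rfl : p = s ^ 2 / 8 := by linarith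
  unfold D
  ring

lemma D_cross (p s : ℝ) (h : 8 * p = s ^ 2) (hs : 4 ≤ s) (a b : ℝ) (ha : 0 ≤ a) (hab : a < b)
    (hD : 0 ≤ D p (2 * p + 1 + s + a)) : 0 < D p (2 * p + 1 + s + b) := by
  have e1 := D_exp p s a h
  have e2 := D_exp p s b h
  generalize ((D p (2 * p + 1 + s + 1) - D p (2 * p + 1 + s)) - 1 - (s ^ 2 / 2 + 4 * s)
        - (s ^ 4 / 16 + 3 * s ^ 3 / 2 + 4 * s ^ 2)) = k at e1 e2
  have h3 : 0 < s ^ 2 / 2 + 4 * s := by positivity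
  have h2 : 0 < s ^ 4 / 16 + 3 * s ^ 3 / 2 + 4 * s ^ 2 := by positivity
  have h0 : 0 < s ^ 3 * (64 * s ^ 2 + 320 * s + 512) / 256 := by positivity
  generalize s ^ 2 / 2 + 4 * s = a3 at *
  generalize s ^ 4 / 16 + 3 * s ^ 3 / 2 + 4 * s ^ 2 = a2 at *
  generalize s ^ 3 * (64 * s ^ 2 + 320 * s + 512) / 256 = a0 at *
  have hb : 0 < b := by linarith
  have ha' : 0 < a := by
    rcases ha.eq_or_lt with rfl | h
    · norm_num at e1 hD; linarith
    · exact h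
  have hba : 0 < b - a := by linarith
  have key : a * D p (2 * p + 1 + s + b) = b * D p (2 * p + 1 + s + a) +
      (b - a) * (a * b * (b ^ 2 + a * b + a ^ 2) + a3 * (a * b * (a + b)) + a2 * (a * b) + a0) := by
    rw [e1, e2]; ring
  have : 0 < a * D p (2 * p + 1 + s + b) := by rw [key]; positivity
  exact pos_of_mul_pos_right this ha

theorem stmt_6 (p : ℝ) (hp : 2 ≤ p) :
    ∃! cstar : ℝ, 2 * p + 1 + Real.sqrt (8 * p) ≤ cstar ∧ D p cstar = 0 ∧
      (∀ c : ℝ, 2 * p + 1 + Real.sqrt (8 * p) ≤ c → c < cstar → D p c < 0) ∧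
      (∀ c : ℝ, cstar < c → 0 < D p c) := by
  have h : 8 * p = Real.sqrt (8 * p) ^ 2 := (Real.sq_sqrt (by linarith)).symm
  have hs : 4 ≤ Real.sqrt (8 * p) := Real.le_sqrt_of_sq_le (by linarith)
  generalize Real.sqrt (8 * p) = s at *
  have cross : ∀ a b : ℝ, 2 * p + 1 + s ≤ a → a < b → 0 ≤ D p a → 0 < D p b := by
    intro a b ha hab hD
    have := D_cross p s h hs (a - (2 * p + 1 + s)) (b - (2 * p + 1 + s)) (by linarith)
      (by linarith) (by simpa using hD)
    simpa using this
  have hneg : D p (2 * p + 1 + s) < 0 := by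
    have e := D_exp p s 0 h
    have h0 : 0 < s ^ 3 * (64 * s ^ 2 + 320 * s + 512) / 256 := by positivity
    norm_num at e
    linarith
  have hpos : 0 < D p (16 * p + 1) := by
    have e : D p (16 * p + 1) = 16 * p ^ 2 * (4096 * p ^ 2 - 15 * (8 * p + 1) ^ 2) := by
      unfold D; ring
    rw [e]
    have : 0 < 4096 * p ^ 2 - 15 * (8 * p + 1) ^ 2 := by nlinarith
    positivity
  have hle : 2 * p + 1 + s ≤ 16 * p + 1 := by nlinarith
  have hc : Continuous (D p) := by unfold D; fun_prop
  obtain ⟨c, ⟨hc1, hc2⟩, hc0⟩ := intermediate_value_Icc hle hc.continuousOn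
    (show (0 : ℝ) ∈ Set.Icc _ _ from ⟨hneg.le, hpos.le⟩)
  refine ⟨c, ⟨hc1, hc0, ?_, ?_⟩, ?_⟩
  · intro x hx hxc
    by_contra hn
    have := cross x c hx hxc (not_lt.mp hn)
    linarith
  · intro x hx
    exact cross c x hc1 hx hc0.ge
  · rintro y ⟨hy1, hy0, -, -⟩
    rcases lt_trichotomy y c with hl | hl | hl
    · have := cross y c hy1 hl hy0.ge
      linarith
    · exact hl
    · have := cross c y hc1 hl hc0.ge
      linarith
end

section
/- Let p ≥ 2 be a real number and let c be a real number with c ≥ 2p + 1 + √(8p) and D_p(c) = 0. Then 2p + 3 + √(8(p-1)) ≤ c ≤ 2p + 3 + √(8p). -/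
theorem stmt_7 (p c : ℝ) (hp : 2 ≤ p)
    (hc : 2 * p + 1 + Real.sqrt (8 * p) ≤ c) (hroot : D p c = 0) :
    2 * p + 3 + Real.sqrt (8 * (p - 1)) ≤ c ∧ c ≤ 2 * p + 3 + Real.sqrt (8 * p) := by
  have h4 : 4 ≤ Real.sqrt (8 * p) := Real.le_sqrt_of_sq_le (by linarith)
  have hc9 : 9 ≤ c := by linarith
  obtain ⟨s, hs0, rfl⟩ : ∃ s : ℝ, 0 ≤ s ∧ s ^ 2 = c :=
    ⟨Real.sqrt c, Real.sqrt_nonneg c, Real.sq_sqrt (by linarith)⟩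
  have hpos : 0 < s ^ 2 + 1 := by positivity
  have hfac : (2 * p * (s ^ 2 + 1) - (s ^ 2 - 1) * (s - 1) ^ 2) *
      (2 * p * (s ^ 2 + 1) - (s ^ 2 - 1) * (s + 1) ^ 2) = 0 := by
    unfold D at hroot
    linear_combination hroot
  have hmain : 2 * p * (s ^ 2 + 1) = (s ^ 2 - 1) * (s - 1) ^ 2 := by
    rcases mul_eq_zero.mp hfac with h | h
    · linarith
    · exfalso
      have h1 : 2 * p * (s ^ 2 + 1) ≤ (s ^ 2 - 5) * (s ^ 2 + 1) :=
        mul_le_mul_of_nonneg_right (by linarith) hpos.le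
      have h2 : 0 ≤ (s ^ 2 - 1) * s := mul_nonneg (by linarith) hs0
      nlinarith
  obtain ⟨u, hu⟩ : ∃ u : ℝ, u = 4 * s / (s ^ 2 + 1) := ⟨_, rfl⟩
  have hu' : u * (s ^ 2 + 1) = 4 * s := by rw [hu]; field_simp
  have h2p : 2 * p = s ^ 2 - 1 - 2 * s + u := by
    apply mul_right_cancel₀ hpos.ne'
    linear_combination hmain - hu'
  have hw : s ^ 2 - 2 * p - 3 = 2 * s - 2 - u := by linarith
  have hd : (s ^ 2 - 2 * p - 3) ^ 2 - 8 * p = 8 - 4 * u * s + u ^ 2 := by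
    rw [hw]; linear_combination (-4) * h2p
  have hus : (4 - u * s) * (s ^ 2 + 1) = 4 := by linear_combination (-s) * hu'
  constructor
  · have h : Real.sqrt (8 * (p - 1)) ≤ s ^ 2 - 2 * p - 3 := by
      apply Real.sqrt_le_iff.mpr
      refine ⟨by linarith, ?_⟩
      have : 0 ≤ 4 - u * s := by
        by_contra! hh
        nlinarith
      nlinarith [sq_nonneg u]
    linarith
  · have h : s ^ 2 - 2 * p - 3 ≤ Real.sqrt (8 * p) := by
      apply Real.le_sqrt_of_sq_le
      have h1 : 4 - u * s ≤ 2 / 5 := by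
        by_contra! hh
        nlinarith
      have h3 : 3 ≤ s := by nlinarith
      have hu0 : 0 ≤ u := by rw [hu]; positivity
      have h2 : u ≤ 6 / 5 := by
        rw [hu, div_le_iff₀ hpos]; nlinarith
      nlinarith
    linarith
end

section
/- Let p ≥ 1 be a real number. For every real number a > 1, one has 1 + ((p+1)(a^2-1) + 2)/(a-1) ≥ 2p + 3 + √(8(p+1)), with equality when a = 1 + √(2/(p+1)). -/
theorem stmt_11 (p : ℝ) (hp : 1 ≤ p) :
    (∀ a : ℝ, 1 < a →
      2 * p + 3 + Real.sqrt (8 * (p + 1)) ≤ 1 + ((p + 1) * (a ^ 2 - 1) + 2) / (a - 1)) ∧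
    (∀ a : ℝ, a = 1 + Real.sqrt (2 / (p + 1)) →
      1 + ((p + 1) * (a ^ 2 - 1) + 2) / (a - 1) = 2 * p + 3 + Real.sqrt (8 * (p + 1))) := by
  have hq : 0 < p + 1 := by linarith
  have key : ∀ a : ℝ, 1 < a → 1 + ((p + 1) * (a ^ 2 - 1) + 2) / (a - 1)
      = 2 * p + 3 + ((p + 1) * (a - 1) + 2 / (a - 1)) := by
    intro a ha
    have h : a - 1 ≠ 0 := by linarith
    field_simp
    ring
  constructor
  · intro a ha
    rw [key a ha]
    have ht : 0 < a - 1 := by linarith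
    have h1 : (a - 1) * (2 / (a - 1)) = 2 := by field_simp
    have h2 : 0 < 2 / (a - 1) := by positivity
    have : Real.sqrt (8 * (p + 1)) ≤ (p + 1) * (a - 1) + 2 / (a - 1) := by
      apply Real.sqrt_le_iff.mpr
      refine ⟨by positivity, ?_⟩
      have h3 : ((p + 1) * (a - 1) + 2 / (a - 1)) ^ 2
          = ((p + 1) * (a - 1) - 2 / (a - 1)) ^ 2 + 8 * (p + 1) := by
        linear_combination 4 * (p + 1) * h1
      nlinarith [sq_nonneg ((p + 1) * (a - 1) - 2 / (a - 1))]
    linarith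
  · intro a ha
    have hs : 0 < Real.sqrt (2 / (p + 1)) := by positivity
    have hsq : Real.sqrt (2 / (p + 1)) ^ 2 = 2 / (p + 1) := Real.sq_sqrt (by positivity)
    rw [key a (by linarith)]
    have hat : a - 1 = Real.sqrt (2 / (p + 1)) := by linarith
    rw [hat]
    set t := Real.sqrt (2 / (p + 1)) with htdef
    have h1 : (p + 1) * t ^ 2 = 2 := by rw [hsq]; field_simp
    have h2 : 2 / t = (p + 1) * t := by
      rw [div_eq_iff hs.ne']
      linarith
    have h3 : Real.sqrt (8 * (p + 1)) = 2 * ((p + 1) * t) := by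
      rw [Real.sqrt_eq_iff_mul_self_eq (by positivity) (by positivity)]
      linear_combination -4 * (p + 1) * h1
    rw [h2, h3]
    ring
end

section
/- Let c > 2 be a real number and let (x_i)_{i≥0} be a sequence of positive real numbers with x_0 ≥ 1 such that for every i ≥ 0, x_i ≥ (2/c)·(x_0 + x_1 + ... + x_i). Then for every i ≥ 0, the partial sum x_0 + x_1 + ... + x_i is at least (c/(c-2))^i, and consequently x_i ≥ (2/c)·(c/(c-2))^i. -/
theorem stmt_12 (c : ℝ) (hc : 2 < c) (x : ℕ → ℝ) (hpos : ∀ i, 0 < x i)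
    (hx0 : 1 ≤ x 0)
    (hgrow : ∀ i, (2 / c) * ∑ j ∈ Finset.range (i + 1), x j ≤ x i) :
    ∀ i, (c / (c - 2)) ^ i ≤ ∑ j ∈ Finset.range (i + 1), x j ∧
      (2 / c) * (c / (c - 2)) ^ i ≤ x i := by
  have hc0 : 0 < c := by linarith
  have hc2 : 0 < c - 2 := by linarith
  have key : ∀ i, (c / (c - 2)) ^ i ≤ ∑ j ∈ Finset.range (i + 1), x j := by
    intro i
    induction i with
    | zero => simpa using hx0
    | succ k ih =>
      have h1 := hgrow (k + 1)
      have h2 := Finset.sum_range_succ x (k + 1)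
      set S := ∑ j ∈ Finset.range (k + 1), x j
      set T := ∑ j ∈ Finset.range (k + 1 + 1), x j
      have h3 : 2 * T ≤ x (k + 1) * c := by
        rw [div_mul_eq_mul_div, div_le_iff₀ hc0] at h1
        exact h1
      have h4 : x (k + 1) = T - S := by linarith
      rw [h4] at h3
      have h5 : S * c ≤ T * (c - 2) := by linarith
      rw [pow_succ]
      calc (c / (c - 2)) ^ k * (c / (c - 2)) ≤ S * (c / (c - 2)) := by gcongr
        _ = S * c / (c - 2) := by ring
        _ ≤ T := by rw [div_le_iff₀ hc2]; exact h5
  intro i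
  refine ⟨key i, le_trans ?_ (hgrow i)⟩
  exact mul_le_mul_of_nonneg_left (key i) (by positivity)
end
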